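/- Let Z be a C³ solution of equation (5.11): ρ(ρ+1)Z_ρρ + ρZ_ρ + Z_ψψ = 0, and let ρ(x,y), ψ(x,y) be differentiable functions with ρ ≠ 0 satisfying the relations (5.13): Z_ρ(ρ,ψ) = −x cos ψ + y sin ψ and Z_ψ(ρ,ψ) = xρ sin ψ + yρ cos ψ, at a point where D = ρ(ρ+1)Z_ρρ² + (Z_ψρ − Z_ψ/ρ)² ≠ 0. Then the partial derivatives of ρ and ψ are given by the formulas (5.14): ρ_x = (1/D)(ρZ_ρψ sin ψ + Z_ψψ cos ψ + ρZ_ρ cos ψ − Z_ψ sin ψ); ρ_y = (1/D)(ρZ_ρψ cos ψ − Z_ψψ sin ψ − ρZ_ρ sin ψ − Z_ψ cos ψ); ψ_x = (1/D)(−ρZ_ρρ sin ψ − Z_ρψ cos ψ + (1/ρ)Z_ψ cos ψ); ψ_y = (1/D)(−ρZ_ρρ cos ψ + Z_ρψ sin ψ − (1/ρ)Z_ψ sin ψ), where all derivatives of Z are evaluated at (ρ(x,y), ψ(x,y)). -/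

import Mathlib

open Real

/-- Partial derivative in the first variable of a function on `ℝ²`. -/
noncomputable def pdx (f : ℝ × ℝ → ℝ) (p : ℝ × ℝ) : ℝ := deriv (fun t => f (t, p.2)) p.1

/-- Partial derivative in the second variable of a function on `ℝ²`. -/
noncomputable def pdy (f : ℝ × ℝ → ℝ) (p : ℝ × ℝ) : ℝ := deriv (fun t => f (p.1, t)) p.2

theorem hasDerivAt_pdx {f : ℝ × ℝ → ℝ} {p : ℝ × ℝ} (hf : DifferentiableAt ℝ f p) :
    HasDerivAt (fun t => f (t, p.2)) (pdx f p) p.1 :=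
  (DifferentiableAt.comp (f := fun t : ℝ => (t, p.2)) p.1 hf
    (differentiableAt_id.prodMk (differentiableAt_const _))).hasDerivAt

theorem hasDerivAt_pdy {f : ℝ × ℝ → ℝ} {p : ℝ × ℝ} (hf : DifferentiableAt ℝ f p) :
    HasDerivAt (fun t => f (p.1, t)) (pdy f p) p.2 :=
  (DifferentiableAt.comp (f := fun t : ℝ => (p.1, t)) p.2 hf
    ((differentiableAt_const _).prodMk differentiableAt_id)).hasDerivAt

theorem pdx_eq_fderiv {f : ℝ × ℝ → ℝ} {p : ℝ × ℝ} (hf : DifferentiableAt ℝ f p) :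
    pdx f p = fderiv ℝ f p (1, 0) :=
  (HasFDerivAt.comp_hasDerivAt (f := fun t : ℝ => (t, p.2)) p.1 hf.hasFDerivAt
    ((hasDerivAt_id _).prodMk (hasDerivAt_const _ _))).deriv

theorem pdy_eq_fderiv {f : ℝ × ℝ → ℝ} {p : ℝ × ℝ} (hf : DifferentiableAt ℝ f p) :
    pdy f p = fderiv ℝ f p (0, 1) :=
  (HasFDerivAt.comp_hasDerivAt (f := fun t : ℝ => (p.1, t)) p.2 hf.hasFDerivAt
    ((hasDerivAt_const _ _).prodMk (hasDerivAt_id _))).deriv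

/-- The chain rule along a plane curve, in terms of partial derivatives. -/
theorem hasDerivAt_comp_curve {f : ℝ × ℝ → ℝ} {r s : ℝ → ℝ} {r' s' t : ℝ}
    (hf : DifferentiableAt ℝ f (r t, s t)) (hr : HasDerivAt r r' t) (hs : HasDerivAt s s' t) :
    HasDerivAt (fun τ => f (r τ, s τ))
      (pdx f (r t, s t) * r' + pdy f (r t, s t) * s') t := by
  have h := HasFDerivAt.comp_hasDerivAt (f := fun τ => (r τ, s τ)) t hf.hasFDerivAt (hr.prodMk hs)
  have hv : ((r', s') : ℝ × ℝ) = r' • (1, 0) + s' • (0, 1) := by simp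
  rw [hv, map_add, map_smul, map_smul, ← pdx_eq_fderiv hf, ← pdy_eq_fderiv hf, smul_eq_mul,
    smul_eq_mul, mul_comm r', mul_comm s'] at h
  exact h

theorem pdx_eventuallyEq_fderiv {f : ℝ × ℝ → ℝ} {q : ℝ × ℝ} (hf : ContDiffAt ℝ 2 f q) :
    pdx f =ᶠ[nhds q] fun p => fderiv ℝ f p (1, 0) := by
  filter_upwards [hf.eventually (by simp)] with p hp
  exact pdx_eq_fderiv (hp.differentiableAt (by simp))

theorem pdy_eventuallyEq_fderiv {f : ℝ × ℝ → ℝ} {q : ℝ × ℝ} (hf : ContDiffAt ℝ 2 f q) :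
    pdy f =ᶠ[nhds q] fun p => fderiv ℝ f p (0, 1) := by
  filter_upwards [hf.eventually (by simp)] with p hp
  exact pdy_eq_fderiv (hp.differentiableAt (by simp))

theorem differentiableAt_fderiv_of_contDiffAt_two {f : ℝ × ℝ → ℝ} {q : ℝ × ℝ}
    (hf : ContDiffAt ℝ 2 f q) : DifferentiableAt ℝ (fderiv ℝ f) q :=
  (hf.fderiv_right (m := 1) (by norm_num)).differentiableAt (by simp)

theorem differentiableAt_pdx {f : ℝ × ℝ → ℝ} {q : ℝ × ℝ} (hf : ContDiffAt ℝ 2 f q) :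
    DifferentiableAt ℝ (pdx f) q :=
  ((differentiableAt_fderiv_of_contDiffAt_two hf).clm_apply
    (differentiableAt_const _)).congr_of_eventuallyEq (pdx_eventuallyEq_fderiv hf)

theorem differentiableAt_pdy {f : ℝ × ℝ → ℝ} {q : ℝ × ℝ} (hf : ContDiffAt ℝ 2 f q) :
    DifferentiableAt ℝ (pdy f) q :=
  ((differentiableAt_fderiv_of_contDiffAt_two hf).clm_apply
    (differentiableAt_const _)).congr_of_eventuallyEq (pdy_eventuallyEq_fderiv hf)

theorem pdx_pdy_comm {f : ℝ × ℝ → ℝ} {q : ℝ × ℝ} (hf : ContDiffAt ℝ 2 f q) :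
    pdx (pdy f) q = pdy (pdx f) q := by
  have hd := differentiableAt_fderiv_of_contDiffAt_two hf
  rw [pdx_eq_fderiv (differentiableAt_pdy hf), pdy_eq_fderiv (differentiableAt_pdx hf),
    (pdy_eventuallyEq_fderiv hf).fderiv_eq, (pdx_eventuallyEq_fderiv hf).fderiv_eq,
    fderiv_clm_apply hd (differentiableAt_const _), fderiv_clm_apply hd (differentiableAt_const _)]
  simpa using (hf.isSymmSndFDerivAt (by simp)).eq (1, 0) (0, 1)

/-- Differentiating the two relations along a curve gives a linear system for `(r', s')`. -/
theorem linear_system_of_relations {Z : ℝ × ℝ → ℝ} {x y r s : ℝ → ℝ} {x' y' r' s' t : ℝ}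
    (hZ : ContDiffAt ℝ 2 Z (r t, s t))
    (hx : HasDerivAt x x' t) (hy : HasDerivAt y y' t)
    (hr : HasDerivAt r r' t) (hs : HasDerivAt s s' t) (hr0 : r t ≠ 0)
    (h₁ : ∀ᶠ τ in nhds t, pdx Z (r τ, s τ) = -x τ * cos (s τ) + y τ * sin (s τ))
    (h₂ : ∀ᶠ τ in nhds t, pdy Z (r τ, s τ) = x τ * r τ * sin (s τ) + y τ * r τ * cos (s τ)) :
    pdx (pdx Z) (r t, s t) * r' + (pdy (pdx Z) (r t, s t) - pdy Z (r t, s t) / r t) * s'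
      = -x' * cos (s t) + y' * sin (s t) ∧
    (pdy (pdx Z) (r t, s t) - pdy Z (r t, s t) / r t) * r'
        + (pdy (pdy Z) (r t, s t) + r t * pdx Z (r t, s t)) * s'
      = r t * (x' * sin (s t) + y' * cos (s t)) := by
  have e₁ := ((hasDerivAt_comp_curve (differentiableAt_pdx hZ) hr hs).congr_of_eventuallyEq
    (h₁.mono fun _ h => h.symm)).unique ((hx.neg.mul hs.cos).add (hy.mul hs.sin))
  have e₂ := ((hasDerivAt_comp_curve (differentiableAt_pdy hZ) hr hs).congr_of_eventuallyEq
    (h₂.mono fun _ h => h.symm)).unique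
      (((hx.mul hr).mul hs.sin).add ((hy.mul hr).mul hs.cos))
  have hq : pdy Z (r t, s t) / r t = x t * sin (s t) + y t * cos (s t) := by
    rw [h₂.self_of_nhds]
    field_simp
  rw [pdx_pdy_comm hZ] at e₂
  simp only [Pi.neg_apply, Pi.mul_apply] at e₁ e₂
  rw [hq, h₁.self_of_nhds]
  constructor
  · linear_combination e₁
  · linear_combination e₂

/-- Cramer's rule for a symmetric `2 × 2` system with determinant `-D`. -/
theorem symmetric_system_solution {a m k D u v r' s' : ℝ} (hD : D ≠ 0)
    (hdet : a * k - m ^ 2 = -D) (h₁ : a * r' + m * s' = u) (h₂ : m * r' + k * s' = v) :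
    r' = 1 / D * (m * v - k * u) ∧ s' = 1 / D * (m * u - a * v) := by
  constructor
  · field_simp
    linear_combination r' * hdet - k * h₁ + m * h₂
  · field_simp
    linear_combination s' * hdet - a * h₂ + m * h₁

/-- Differentiating the relations (5.13) yields the explicit formulas
(5.14) for the partial derivatives `ρ_x, ρ_y, ψ_x, ψ_y` at a point where `D ≠ 0`. -/
theorem statement12 (V : Set (ℝ × ℝ)) (hV : IsOpen V)
    (Z : ℝ × ℝ → ℝ) (hZ : ContDiffOn ℝ 3 Z V)
    (h511 : ∀ q ∈ V,
      q.1 * (q.1 + 1) * pdx (pdx Z) q + q.1 * pdx Z q + pdy (pdy Z) q = 0)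
    (U : Set (ℝ × ℝ)) (hU : IsOpen U)
    (ρ ψ : ℝ × ℝ → ℝ)
    (hρ : DifferentiableOn ℝ ρ U) (hψ : DifferentiableOn ℝ ψ U)
    (hρ0 : ∀ p ∈ U, ρ p ≠ 0)
    (hmem : ∀ p ∈ U, (ρ p, ψ p) ∈ V)
    (h513a : ∀ p ∈ U,
      pdx Z (ρ p, ψ p) = -p.1 * Real.cos (ψ p) + p.2 * Real.sin (ψ p))
    (h513b : ∀ p ∈ U,
      pdy Z (ρ p, ψ p) = p.1 * ρ p * Real.sin (ψ p) + p.2 * ρ p * Real.cos (ψ p))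
    (p₀ : ℝ × ℝ) (hp₀ : p₀ ∈ U)
    (D : ℝ)
    (hDdef : D = ρ p₀ * (ρ p₀ + 1) * (pdx (pdx Z) (ρ p₀, ψ p₀)) ^ 2
      + (pdy (pdx Z) (ρ p₀, ψ p₀) - pdy Z (ρ p₀, ψ p₀) / ρ p₀) ^ 2)
    (hD : D ≠ 0) :
    pdx ρ p₀ = (1 / D) * (ρ p₀ * pdy (pdx Z) (ρ p₀, ψ p₀) * Real.sin (ψ p₀)
        + pdy (pdy Z) (ρ p₀, ψ p₀) * Real.cos (ψ p₀)
        + ρ p₀ * pdx Z (ρ p₀, ψ p₀) * Real.cos (ψ p₀)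
        - pdy Z (ρ p₀, ψ p₀) * Real.sin (ψ p₀)) ∧
    pdy ρ p₀ = (1 / D) * (ρ p₀ * pdy (pdx Z) (ρ p₀, ψ p₀) * Real.cos (ψ p₀)
        - pdy (pdy Z) (ρ p₀, ψ p₀) * Real.sin (ψ p₀)
        - ρ p₀ * pdx Z (ρ p₀, ψ p₀) * Real.sin (ψ p₀)
        - pdy Z (ρ p₀, ψ p₀) * Real.cos (ψ p₀)) ∧
    pdx ψ p₀ = (1 / D) * (-(ρ p₀ * pdx (pdx Z) (ρ p₀, ψ p₀) * Real.sin (ψ p₀))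
        - pdy (pdx Z) (ρ p₀, ψ p₀) * Real.cos (ψ p₀)
        + (1 / ρ p₀) * pdy Z (ρ p₀, ψ p₀) * Real.cos (ψ p₀)) ∧
    pdy ψ p₀ = (1 / D) * (-(ρ p₀ * pdx (pdx Z) (ρ p₀, ψ p₀) * Real.cos (ψ p₀))
        + pdy (pdx Z) (ρ p₀, ψ p₀) * Real.sin (ψ p₀)
        - (1 / ρ p₀) * pdy Z (ρ p₀, ψ p₀) * Real.sin (ψ p₀)) := by
  have hUp : U ∈ nhds p₀ := hU.mem_nhds hp₀
  have hZ₂ : ContDiffAt ℝ 2 Z (ρ p₀, ψ p₀) :=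
    (hZ.contDiffAt (hV.mem_nhds (hmem p₀ hp₀))).of_le (by norm_num)
  have hρd := hρ.differentiableAt hUp
  have hψd := hψ.differentiableAt hUp
  have hr := hρ0 p₀ hp₀
  have hX : ∀ᶠ τ in nhds p₀.1, (τ, p₀.2) ∈ U :=
    (Continuous.prodMk_left p₀.2).continuousAt.preimage_mem_nhds hUp
  have hY : ∀ᶠ τ in nhds p₀.2, (p₀.1, τ) ∈ U :=
    (Continuous.prodMk_right p₀.1).continuousAt.preimage_mem_nhds hUp
  obtain ⟨a₁, a₂⟩ := linear_system_of_relations hZ₂ (hasDerivAt_id p₀.1)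
    (hasDerivAt_const p₀.1 p₀.2) (hasDerivAt_pdx hρd) (hasDerivAt_pdx hψd) hr
    (hX.mono fun _ h => h513a _ h) (hX.mono fun _ h => h513b _ h)
  obtain ⟨b₁, b₂⟩ := linear_system_of_relations hZ₂ (hasDerivAt_const p₀.2 p₀.1)
    (hasDerivAt_id p₀.2) (hasDerivAt_pdy hρd) (hasDerivAt_pdy hψd) hr
    (hY.mono fun _ h => h513a _ h) (hY.mono fun _ h => h513b _ h)
  have hdet : pdx (pdx Z) (ρ p₀, ψ p₀)
        * (pdy (pdy Z) (ρ p₀, ψ p₀) + ρ p₀ * pdx Z (ρ p₀, ψ p₀))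
      - (pdy (pdx Z) (ρ p₀, ψ p₀) - pdy Z (ρ p₀, ψ p₀) / ρ p₀) ^ 2 = -D := by
    linear_combination hDdef + pdx (pdx Z) (ρ p₀, ψ p₀) * h511 _ (hmem p₀ hp₀)
  obtain ⟨c₁, c₂⟩ := symmetric_system_solution hD hdet a₁ a₂
  obtain ⟨d₁, d₂⟩ := symmetric_system_solution hD hdet b₁ b₂
  refine ⟨c₁.trans ?_, d₁.trans ?_, c₂.trans ?_, d₂.trans ?_⟩ <;>
  · congr 1
    field_simp
    ring
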